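/- Let G be a connected, non-bipartite, k-regular finite simple graph on n vertices with k ≥ 3, and suppose G is Ramanujan, i.e., λ(G) ≤ 2√(k − 1), where λ(G) is the largest absolute value among the eigenvalues μ of the adjacency matrix with |μ| < k. Assume also λ(G) > 0. Then the diameter of G satisfies diam(G) ≤ 1 + 2·log(2n)/log(k − 1). -/

import Mathlib

/-- `μ` is an eigenvalue of the (real) adjacency matrix of the graph `G`. -/
def IsAdjEigenvalue {V : Type*} [Fintype V] (G : SimpleGraph V) [DecidableRel G.Adj]
    (μ : ℝ) : Prop :=
  ∃ x : V → ℝ, x ≠ 0 ∧ (G.adjMatrix ℝ).mulVec x = μ • x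

/-- A graph is bipartite if its vertex set splits into two parts with all edges going
between the parts. -/
def IsBipartite {V : Type*} (G : SimpleGraph V) : Prop :=
  ∃ s : Set V, ∀ ⦃u v⦄, G.Adj u v → (u ∈ s ↔ v ∉ s)

open Polynomial in
/-- Entries of a polynomial in a real symmetric matrix, expanded in an orthonormal eigenbasis. -/
lemma Matrix.IsHermitian.aeval_apply_eq_sum {n : Type*} [Fintype n] [DecidableEq n]
    {A : Matrix n n ℝ} (hA : A.IsHermitian) (p : ℝ[X]) (x y : n) :
    (aeval A p) x y = ∑ i, p.eval (hA.eigenvalues i) *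
      (hA.eigenvectorBasis i x * hA.eigenvectorBasis i y) := by
  have hD : aeval (Matrix.diagonal hA.eigenvalues) p =
      Matrix.diagonal fun i => p.eval (hA.eigenvalues i) := by
    have h := aeval_algHom_apply (Matrix.diagonalAlgHom (n := n) (α := ℝ) ℝ) hA.eigenvalues p
    simp only [Matrix.diagonalAlgHom_apply] at h
    rw [h]
    congr 1
    ext i
    simp
  conv_lhs => rw [hA.spectral_theorem]
  rw [show (RCLike.ofReal ∘ hA.eigenvalues : n → ℝ) = hA.eigenvalues from rfl,
    aeval_algHom_apply, hD, Unitary.conjStarAlgAut_apply, Matrix.mul_apply]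
  refine Finset.sum_congr rfl fun i _ => ?_
  simp [Matrix.mul_diagonal, Matrix.star_apply]
  ring

lemma Matrix.IsHermitian.sum_eigenvectorBasis_sq_row {n : Type*} [Fintype n] [DecidableEq n]
    {A : Matrix n n ℝ} (hA : A.IsHermitian) (x : n) :
    ∑ i, hA.eigenvectorBasis i x ^ 2 = 1 := by
  have h := hA.aeval_apply_eq_sum 1 x x
  simp only [map_one, Matrix.one_apply_eq, Polynomial.eval_one, one_mul] at h
  simpa only [sq] using h.symm

lemma Matrix.IsHermitian.sum_eigenvectorBasis_sq_col {n : Type*} [Fintype n] [DecidableEq n]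
    {A : Matrix n n ℝ} (hA : A.IsHermitian) (i : n) :
    ∑ x, hA.eigenvectorBasis i x ^ 2 = 1 := by
  rw [← EuclideanSpace.real_norm_sq_eq, hA.eigenvectorBasis.orthonormal.norm_eq_one, one_pow]

namespace SimpleGraph

variable {V : Type*} [Fintype V] {G : SimpleGraph V} [DecidableRel G.Adj] {k : ℕ}

/-- The signed Dirichlet form of an adjacency eigenvector of a regular graph. -/
lemma sum_sum_neighbor_sq_of_mulVec_eq (hreg : G.IsRegularOfDegree k) {μ ε : ℝ}
    (hε : ε ^ 2 = 1) {x : V → ℝ} (hx : (G.adjMatrix ℝ).mulVec x = μ • x) :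
    ∑ v, ∑ w ∈ G.neighborFinset v, (x v - ε * x w) ^ 2 =
      2 * (k - ε * μ) * ∑ v, x v ^ 2 := by
  have hA (v : V) : ∑ w ∈ G.neighborFinset v, x w = μ * x v := by
    rw [← adjMatrix_mulVec_apply, hx, Pi.smul_apply, smul_eq_mul]
  have hsq : ∑ v, ∑ w ∈ G.neighborFinset v, x w ^ 2 = ∑ v, k * x v ^ 2 := by
    simp_rw [neighborFinset_eq_filter, Finset.sum_filter]
    rw [Finset.sum_comm]
    refine Finset.sum_congr rfl fun w _ => ?_
    simp_rw [G.adj_comm _ w]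
    rw [← Finset.sum_filter, ← neighborFinset_eq_filter, Finset.sum_const,
      card_neighborFinset_eq_degree, hreg w, nsmul_eq_mul]
  have hrow (v : V) : ∑ w ∈ G.neighborFinset v, (x v - ε * x w) ^ 2 =
      k * x v ^ 2 - 2 * ε * μ * x v ^ 2 + ∑ w ∈ G.neighborFinset v, x w ^ 2 := by
    have h (w : V) : (x v - ε * x w) ^ 2 = x v ^ 2 - 2 * ε * x v * x w + x w ^ 2 := by
      linear_combination x w ^ 2 * hε
    simp_rw [h]
    rw [Finset.sum_add_distrib, Finset.sum_sub_distrib, ← Finset.mul_sum, hA, Finset.sum_const,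
      card_neighborFinset_eq_degree, hreg v, nsmul_eq_mul]
    ring
  simp_rw [hrow]
  rw [Finset.sum_add_distrib, hsq, ← Finset.sum_add_distrib, Finset.mul_sum]
  exact Finset.sum_congr rfl fun v _ => by ring

lemma mul_eigenvalue_le_of_isRegularOfDegree (hreg : G.IsRegularOfDegree k) {μ ε : ℝ}
    (hε : ε ^ 2 = 1) {x : V → ℝ} (hx0 : x ≠ 0) (hx : (G.adjMatrix ℝ).mulVec x = μ • x) :
    ε * μ ≤ k := by
  have h := sum_sum_neighbor_sq_of_mulVec_eq hreg hε hx
  have hnn : 0 ≤ ∑ v, ∑ w ∈ G.neighborFinset v, (x v - ε * x w) ^ 2 := by positivity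
  obtain ⟨v, hv⟩ := Function.ne_iff.mp hx0
  have hpos : 0 < ∑ v, x v ^ 2 :=
    Finset.sum_pos' (fun _ _ => sq_nonneg _) ⟨v, Finset.mem_univ v, sq_pos_of_ne_zero hv⟩
  rw [h] at hnn
  linarith [nonneg_of_mul_nonneg_left hnn hpos]

lemma eq_mul_of_adj_of_mul_eigenvalue_eq (hreg : G.IsRegularOfDegree k) {μ ε : ℝ}
    (hε : ε ^ 2 = 1) (hμ : ε * μ = k) {x : V → ℝ}
    (hx : (G.adjMatrix ℝ).mulVec x = μ • x) {v w : V} (hvw : G.Adj v w) : x v = ε * x w := by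
  have h := sum_sum_neighbor_sq_of_mulVec_eq hreg hε hx
  rw [hμ, sub_self, mul_zero, zero_mul,
    Finset.sum_eq_zero_iff_of_nonneg fun _ _ => by positivity] at h
  have h' := (Finset.sum_eq_zero_iff_of_nonneg fun _ _ => by positivity).mp
    (h v (Finset.mem_univ v)) w ((G.mem_neighborFinset v w).mpr hvw)
  exact sub_eq_zero.mp (pow_eq_zero_iff two_ne_zero |>.mp h')

lemma Connected.apply_eq_of_forall_adj {V α : Type*} {G : SimpleGraph V} (hconn : G.Connected)
    {f : V → α} (hf : ∀ ⦃v w⦄, G.Adj v w → f v = f w) (v w : V) : f v = f w := by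
  obtain ⟨p⟩ := hconn.preconnected v w
  induction p with
  | nil => rfl
  | cons h _ ih => exact (hf h).trans ih

lemma apply_eq_of_mulVec_eq_degree_smul (hconn : G.Connected) (hreg : G.IsRegularOfDegree k)
    {x : V → ℝ} (hx : (G.adjMatrix ℝ).mulVec x = (k : ℝ) • x) (v w : V) : x v = x w :=
  hconn.apply_eq_of_forall_adj (fun _ _ h => by
    simpa using eq_mul_of_adj_of_mul_eigenvalue_eq hreg (one_pow 2) (one_mul _) hx h) v w

lemma isBipartite_of_mulVec_eq_neg_degree_smul (hconn : G.Connected)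
    (hreg : G.IsRegularOfDegree k) {x : V → ℝ} (hx0 : x ≠ 0)
    (hx : (G.adjMatrix ℝ).mulVec x = (-k : ℝ) • x) : _root_.IsBipartite G := by
  have hadj ⦃v w : V⦄ (h : G.Adj v w) : x v = -x w := by
    simpa using eq_mul_of_adj_of_mul_eigenvalue_eq hreg (ε := -1) (by norm_num) (by ring) hx h
  have habs (v w : V) : |x v| = |x w| :=
    hconn.apply_eq_of_forall_adj (f := fun v => |x v|)
      (fun _ _ h => by simp only [hadj h, abs_neg]) v w
  obtain ⟨u, hu⟩ := Function.ne_iff.mp hx0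
  refine ⟨{v | 0 < x v}, fun v w h => ?_⟩
  have hw : x w ≠ 0 := abs_pos.mp (habs u w ▸ abs_pos.mpr hu)
  simp only [Set.mem_ofPred_eq, hadj h, Left.neg_pos_iff, not_lt]
  exact ⟨le_of_lt, fun h' => lt_of_le_of_ne h' hw⟩

lemma abs_eigenvalue_lt_degree (hconn : G.Connected) (hreg : G.IsRegularOfDegree k)
    (hnbip : ¬ _root_.IsBipartite G) {μ : ℝ} (hμ : IsAdjEigenvalue G μ) (hne : μ ≠ k) :
    |μ| < k := by
  obtain ⟨x, hx0, hx⟩ := hμ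
  have h₁ := mul_eigenvalue_le_of_isRegularOfDegree hreg (ε := 1) (by norm_num) hx0 hx
  have h₂ := mul_eigenvalue_le_of_isRegularOfDegree hreg (ε := -1) (by norm_num) hx0 hx
  have hne' : μ ≠ -k := by
    rintro rfl
    exact hnbip (isBipartite_of_mulVec_eq_neg_degree_smul hconn hreg hx0 hx)
  rw [abs_lt]
  exact ⟨lt_of_le_of_ne (by linarith) hne'.symm, lt_of_le_of_ne (by linarith) hne⟩

open Polynomial in
lemma aeval_adjMatrix_apply_eq_zero [DecidableEq V] {p : ℝ[X]} {u v : V}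
    (h : p.natDegree < G.dist u v) : (aeval (G.adjMatrix ℝ) p) u v = 0 := by
  rw [aeval_eq_sum_range, Matrix.sum_apply]
  refine Finset.sum_eq_zero fun j hj => ?_
  have : IsEmpty {q : G.Walk u v | q.length = j} := by
    refine ⟨fun ⟨q, hq⟩ => ?_⟩
    have h₁ := dist_le q
    have h₂ : q.length = j := hq
    have h₃ := Finset.mem_range.mp hj
    omega
  rw [Matrix.smul_apply, adjMatrix_pow_apply_eq_card_walk, Fintype.card_eq_zero, Nat.cast_zero,
    smul_zero]

open Polynomial in
/-- A polynomial bounded by `1` on the nontrivial spectrum whose degree is smaller than some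
distance in the graph takes a value at most `n` at the trivial eigenvalue. -/
lemma eval_degree_le_card_of_natDegree_lt_dist (hconn : G.Connected)
    (hreg : G.IsRegularOfDegree k) {p : ℝ[X]}
    (hp : ∀ μ, IsAdjEigenvalue G μ → μ ≠ k → |p.eval μ| ≤ 1) {u v : V}
    (h : p.natDegree < G.dist u v) : p.eval (k : ℝ) ≤ Fintype.card V := by
  classical
  have : Nonempty V := ⟨u⟩
  have hn : (0 : ℝ) < Fintype.card V := by exact_mod_cast Fintype.card_pos
  rcases le_or_gt (p.eval (k : ℝ)) 0 with hneg | hpk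
  · exact hneg.trans hn.le
  have hA : (G.adjMatrix ℝ).IsHermitian := by
    simp [Matrix.IsHermitian, Matrix.conjTranspose_eq_transpose_of_trivial]
  set b := hA.eigenvectorBasis
  set e := hA.eigenvalues
  have hb (i : V) : (G.adjMatrix ℝ).mulVec (b i) = e i • ⇑(b i) := hA.mulVec_eigenvectorBasis i
  have he (i : V) : IsAdjEigenvalue G (e i) := by
    refine ⟨b i, fun h0 => ?_, hb i⟩
    have := hA.sum_eigenvectorBasis_sq_col i
    simp [show ⇑(hA.eigenvectorBasis i) = 0 from h0] at this
  have htriv (i : V) (hi : e i = k) : b i u * b i v = 1 / Fintype.card V := by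
    have hc := apply_eq_of_mulVec_eq_degree_smul hconn hreg (hi ▸ hb i)
    have hs : ∑ w, b i w ^ 2 = 1 := hA.sum_eigenvectorBasis_sq_col i
    simp_rw [fun w => hc w v] at hs
    rw [Finset.sum_const, Finset.card_univ, nsmul_eq_mul] at hs
    rw [hc u v, eq_div_iff hn.ne']
    linear_combination hs
  obtain ⟨i₀, hi₀⟩ : ∃ i, e i = k := by
    have : (k : ℝ) ∈ spectrum ℝ (G.adjMatrix ℝ) := by
      rw [← Matrix.spectrum_toLin']
      refine (Module.End.hasEigenvalue_of_hasEigenvector (x := Function.const V 1)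
        ⟨Module.End.mem_eigenspace_iff.mpr ?_, ?_⟩).mem_spectrum
      · ext w
        rw [Matrix.toLin'_apply, adjMatrix_mulVec_const_apply_of_regular hreg]
        simp
      · exact fun h0 => one_ne_zero (congrFun h0 u)
    rwa [hA.spectrum_real_eq_range_eigenvalues] at this
  have hterm (i : V) : (if i = i₀ then p.eval (k : ℝ) / Fintype.card V else 0) -
      (b i u ^ 2 + b i v ^ 2) / 2 ≤ p.eval (e i) * (b i u * b i v) := by
    by_cases hi : e i = k
    · rw [hi, htriv i hi, mul_one_div]
      have : 0 ≤ p.eval (k : ℝ) / Fintype.card V := by positivity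
      split_ifs <;> nlinarith [sq_nonneg (b i u), sq_nonneg (b i v)]
    · rw [if_neg (by rintro rfl; exact hi hi₀)]
      obtain ⟨h₁, h₂⟩ := abs_le.mp (hp _ (he i) hi)
      nlinarith [mul_nonneg (sub_nonneg.mpr h₂) (sq_nonneg (b i u - b i v)),
        mul_nonneg (neg_le_iff_add_nonneg.mp h₁) (sq_nonneg (b i u + b i v))]
  have hsum := Finset.sum_le_sum fun i (_ : i ∈ Finset.univ) => hterm i
  have hzero := hA.aeval_apply_eq_sum p u v
  rw [aeval_adjMatrix_apply_eq_zero h] at hzero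
  rw [← hzero, Finset.sum_sub_distrib, Finset.sum_ite_eq' Finset.univ i₀,
    if_pos (Finset.mem_univ _), ← Finset.sum_div, Finset.sum_add_distrib,
    hA.sum_eigenvectorBasis_sq_row, hA.sum_eigenvectorBasis_sq_row] at hsum
  exact (div_le_one hn).mp (by linarith)

end SimpleGraph

open Polynomial in
/-- Growth of the rescaled Chebyshev polynomials at `q + 1`. -/
lemma Polynomial.Chebyshev.exp_le_two_mul_eval_T (m : ℕ) {q : ℝ} (hq : 0 < q) :
    Real.exp (m * (Real.log q / 2)) ≤
      2 * (Chebyshev.T ℝ m).eval ((2 * √q)⁻¹ * (q + 1)) := by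
  have hcosh : (2 * √q)⁻¹ * (q + 1) = Real.cosh (Real.log q / 2) := by
    have hs : 0 < √q := Real.sqrt_pos.mpr hq
    rw [← Real.log_sqrt hq.le, Real.cosh_log hs]
    field_simp
    rw [Real.sq_sqrt hq.le]
  rw [hcosh, Chebyshev.T_real_cosh, Real.cosh_eq]
  push_cast
  linarith [Real.exp_pos (-(m * (Real.log q / 2)))]

/-- A connected non-bipartite `k`-regular Ramanujan graph (`k ≥ 3`) on `n` vertices, with
`λ(G)` the largest absolute value of a nontrivial adjacency eigenvalue, satisfying
`0 < λ(G) ≤ 2√(k − 1)`, has diameter at most `1 + 2·log(2n)/log(k − 1)`. -/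
theorem ramanujan_diameter_bound {V : Type*} [Fintype V]
    (G : SimpleGraph V) [DecidableRel G.Adj] (k : ℕ) (hk : 3 ≤ k)
    (hconn : G.Connected) (hreg : G.IsRegularOfDegree k) (hnbip : ¬ IsBipartite G)
    (lam : ℝ)
    (hlam : IsGreatest {x : ℝ | ∃ μ : ℝ, IsAdjEigenvalue G μ ∧ |μ| < (k : ℝ) ∧ x = |μ|} lam)
    (hpos : 0 < lam) (hram : lam ≤ 2 * Real.sqrt ((k : ℝ) - 1)) :
    (G.diam : ℝ) ≤ 1 + 2 * Real.log (2 * Fintype.card V) / Real.log ((k : ℝ) - 1) := by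
  have hk' : (3 : ℝ) ≤ k := by exact_mod_cast hk
  have := hconn.nonempty
  have hn : (1 : ℝ) ≤ Fintype.card V := by exact_mod_cast Fintype.card_pos
  have hlogk : 0 < Real.log ((k : ℝ) - 1) := Real.log_pos (by linarith)
  have hlogn : 0 ≤ Real.log (2 * Fintype.card V) := Real.log_nonneg (by linarith)
  obtain ⟨u, v, huv⟩ := G.exists_dist_eq_diam
  rcases hd : G.diam with _ | m
  · rw [Nat.cast_zero]
    positivity
  set L := 2 * √((k : ℝ) - 1) with hL
  have hLpos : 0 < L := by
    have := Real.sqrt_pos.mpr (show (0 : ℝ) < k - 1 by linarith)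
    positivity
  let p : Polynomial ℝ := (Polynomial.Chebyshev.T ℝ m).comp (.C L⁻¹ * .X)
  have heval (x : ℝ) : p.eval x = (Polynomial.Chebyshev.T ℝ m).eval (L⁻¹ * x) := by
    simp [p]
  have hdeg : p.natDegree < G.dist u v := by
    have h₁ : p.natDegree ≤ m * 1 := by
      refine Polynomial.natDegree_comp_le.trans (Nat.mul_le_mul ?_ ?_)
      · simp
      · exact (Polynomial.natDegree_C_mul_le _ _).trans Polynomial.natDegree_X_le
    omega
  have hp (μ : ℝ) (hμ : IsAdjEigenvalue G μ) (hne : μ ≠ k) : |p.eval μ| ≤ 1 := by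
    rw [heval]
    refine Polynomial.Chebyshev.abs_eval_T_real_le_one _ ?_
    have h₁ : |μ| ≤ lam :=
      hlam.2 ⟨μ, hμ, SimpleGraph.abs_eigenvalue_lt_degree hconn hreg hnbip hμ hne, rfl⟩
    rw [abs_mul, abs_of_pos (inv_pos.mpr hLpos), inv_mul_le_one₀ hLpos]
    exact h₁.trans hram
  have hle := SimpleGraph.eval_degree_le_card_of_natDegree_lt_dist hconn hreg hp hdeg
  have hexp := Polynomial.Chebyshev.exp_le_two_mul_eval_T m (show (0 : ℝ) < k - 1 by linarith)
  rw [sub_add_cancel, ← hL, ← heval] at hexp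
  have hlog : m * (Real.log ((k : ℝ) - 1) / 2) ≤ Real.log (2 * Fintype.card V) :=
    (Real.le_log_iff_exp_le (by linarith)).mpr (by linarith)
  have hm : (m : ℝ) ≤ 2 * Real.log (2 * Fintype.card V) / Real.log ((k : ℝ) - 1) := by
    rw [le_div_iff₀ hlogk]
    linarith
  push_cast
  linarith
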